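/- arXiv:1412.6396 — 10 statements merged into one kernel-verified Lean document; each statement's English description precedes it below -/
import Mathlib

section
/- Let m ≥ 3 be a natural number and let B be a finite simple graph on a vertex type V. There exists a coloring c : V → ZMod m such that every vertex x has a neighbor y with c(y) = c(x) + 1 if, and only if, every connected component of B contains a cycle whose length is divisible by m (i.e., for every vertex v there is a vertex u reachable from v and a closed walk at u that is a cycle whose length is divisible by m). -/
theorem aux_walk {V : Type*} (B : SimpleGraph V) (f : V → V) (hf : ∀ x, B.Adj x (f x)) :
    ∀ (n : ℕ) (u : V), ∃ p : B.Walk u (f^[n] u), p.length = n ∧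
      ∀ i ≤ n, p.getVert i = f^[i] u := by
  intro n
  induction n with
  | zero =>
    intro u
    refine ⟨SimpleGraph.Walk.nil, rfl, ?_⟩
    intro i hi
    obtain rfl : i = 0 := by omega
    rfl
  | succ n ih =>
    intro u
    obtain ⟨p, hp, hq⟩ := ih (f u)
    refine ⟨SimpleGraph.Walk.cons (hf u) p, by simp [hp], ?_⟩
    intro i hi
    cases i with
    | zero => rfl
    | succ i =>
      exact hq i (by omega)

theorem aux_forward (m : ℕ) (hm : 3 ≤ m) {V : Type*} [Fintype V] (B : SimpleGraph V)
    (c : V → ZMod m) (f : V → V) (hf : ∀ x, B.Adj x (f x)) (hc : ∀ x, c (f x) = c x + 1) (v : V) :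
    ∃ u : V, B.Reachable v u ∧ ∃ p : B.Walk u u, p.IsCycle ∧ m ∣ p.length := by
  have hci : ∀ (n : ℕ) (x : V), c (f^[n] x) = c x + n := by
    intro n
    induction n with
    | zero => intro x; simp
    | succ n ih => intro x; rw [Function.iterate_succ_apply, ih, hc]; push_cast; ring
  obtain ⟨a, b, hab, hE⟩ : ∃ a b : ℕ, a < b ∧ f^[a] v = f^[b] v := by
    obtain ⟨a, b, hne, h⟩ := Finite.exists_ne_map_eq_of_infinite (fun n : ℕ => f^[n] v)
    rcases lt_or_gt_of_ne hne with h1 | h1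
    · exact ⟨a, b, h1, h⟩
    · exact ⟨b, a, h1, h.symm⟩
  set u := f^[a] v with hu
  have hper : u ∈ Function.periodicPts f := by
    refine Function.mk_mem_periodicPts (n := b - a) (by omega) ?_
    change f^[b - a] u = u
    rw [hu, ← Function.iterate_add_apply, Nat.sub_add_cancel hab.le]
    exact hE.symm
  set k := Function.minimalPeriod f u with hk
  have hkpos : 0 < k := Function.minimalPeriod_pos_of_mem_periodicPts hper
  have hku : f^[k] u = u := Function.iterate_minimalPeriod
  have hmk : m ∣ k := by
    have h := hci k u
    rw [hku] at h
    rw [← ZMod.natCast_eq_zero_iff]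
    exact left_eq_add.mp h
  have h3 : 3 ≤ k := hm.trans (Nat.le_of_dvd hkpos hmk)
  obtain ⟨q, -⟩ := aux_walk B f hf a v
  refine ⟨u, ⟨q⟩, ?_⟩
  obtain ⟨p, hp, hpv⟩ := aux_walk B f hf k u
  have key : ∃ p : B.Walk u u, p.length = k ∧ ∀ i ≤ k, p.getVert i = f^[i] u :=
    ⟨p.copy rfl hku, by simpa using hp, by simpa using hpv⟩
  clear hp hpv p
  obtain ⟨p, hp, hpv⟩ := key
  refine ⟨p, ?_, hp ▸ hmk⟩
  rw [SimpleGraph.Walk.isCycle_iff_isPath_tail_and_le_length]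
  refine ⟨?_, by omega⟩
  rw [← SimpleGraph.Walk.IsPath.getVert_injOn_iff]
  have hnn : ¬ p.Nil := by
    intro h
    have := SimpleGraph.Walk.length_eq_zero_iff.mpr h
    omega
  have htl := SimpleGraph.Walk.length_tail_add_one hnn
  intro i hi j hj hij
  have hi' : i ≤ p.tail.length := hi
  have hj' : j ≤ p.tail.length := hj
  rw [SimpleGraph.Walk.getVert_tail, SimpleGraph.Walk.getVert_tail, hpv _ (by omega),
    hpv _ (by omega), Function.iterate_succ_apply, Function.iterate_succ_apply] at hij
  have hk' := Function.minimalPeriod_apply hper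
  exact (Function.iterate_eq_iterate_iff_of_lt_minimalPeriod (by omega) (by omega)).mp hij

open Classical in
theorem aux_backward (m : ℕ) {V : Type*} [Fintype V] (B : SimpleGraph V)
    (H : ∀ v : V, ∃ u : V, B.Reachable v u ∧
      ∃ p : B.Walk u u, p.IsCycle ∧ m ∣ p.length) :
    ∃ c : V → ZMod m, ∀ x : V, ∃ y : V, B.Adj x y ∧ c y = c x + 1 := by
  let P : Set V → Prop := fun S =>
    ∃ c : V → ZMod m, ∀ x ∈ S, ∃ y ∈ S, B.Adj x y ∧ c y = c x + 1
  obtain ⟨S, hS⟩ : ∃ S, Maximal P S := by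
    obtain ⟨S, -, hS⟩ := (Set.toFinite {S | P S}).exists_le_maximal
      (show (∅ : Set V) ∈ {S | P S} from ⟨fun _ => 0, by simp⟩)
    exact ⟨S, hS⟩
  obtain ⟨c, hc⟩ := hS.prop
  suffices hall : ∀ v, v ∈ S by
    refine ⟨c, fun x => ?_⟩
    obtain ⟨y, -, hy⟩ := hc x (hall x)
    exact ⟨y, hy⟩
  have hclosed : ∀ x y, B.Adj x y → y ∈ S → x ∈ S := by
    intro x y hxy hy
    by_contra hx
    have hP : P (insert x S) := by
      refine ⟨Function.update c x (c y - 1), ?_⟩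
      have hne : ∀ z ∈ S, z ≠ x := fun z hz h => hx (h ▸ hz)
      rintro z (rfl | hz)
      · exact ⟨y, Or.inr hy, hxy, by simp [Function.update_of_ne (hne y hy)]⟩
      · obtain ⟨w, hw, hzw, h⟩ := hc z hz
        exact ⟨w, Or.inr hw, hzw, by
          rw [Function.update_of_ne (hne w hw), Function.update_of_ne (hne z hz), h]⟩
    exact hx (hS.le_of_ge hP (Set.subset_insert x S) (Set.mem_insert x S))
  have hreach : ∀ x y, B.Reachable x y → y ∈ S → x ∈ S := by
    rintro x y ⟨p⟩
    induction p with
    | nil => exact id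
    | cons h p ih => exact fun hy => hclosed _ _ h (ih hy)
  intro v
  obtain ⟨u, hvu, p, hp, hd⟩ := H v
  refine hreach v u hvu ?_
  by_contra hu
  have h3 := hp.three_le_length
  have hout : ∀ i, p.getVert i ∉ S := fun i hi => hu (hreach u _ ⟨p.take i⟩ hi)
  let c' : V → ZMod m := fun x =>
    if h : ∃ i, i < p.length ∧ p.getVert i = x then ((Classical.choose h : ℕ) : ZMod m) else c x
  have hc'S : ∀ x ∈ S, c' x = c x := by
    intro x hx
    have : ¬ ∃ i, i < p.length ∧ p.getVert i = x := by
      rintro ⟨i, -, rfl⟩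
      exact hout i hx
    simp only [c', dif_neg this]
  have hc'p : ∀ i, i < p.length → c' (p.getVert i) = i := by
    intro i hi
    have h : ∃ j, j < p.length ∧ p.getVert j = p.getVert i := ⟨i, hi, rfl⟩
    have h2 := Classical.choose_spec h
    have h4 : Classical.choose h = i :=
      hp.getVert_injOn' (show _ ≤ p.length - 1 by omega) (show _ ≤ p.length - 1 by omega) h2.2
    simp only [c', dif_pos h, h4]
  have hP : P (S ∪ {x | ∃ i, i < p.length ∧ p.getVert i = x}) := by
    refine ⟨c', ?_⟩
    rintro z (hz | ⟨i, hi, rfl⟩)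
    · obtain ⟨w, hw, hzw, h⟩ := hc z hz
      exact ⟨w, Or.inl hw, hzw, by rw [hc'S w hw, hc'S z hz, h]⟩
    · have hadj := p.adj_getVert_succ hi
      by_cases hi2 : i + 1 < p.length
      · exact ⟨_, Or.inr ⟨i + 1, hi2, rfl⟩, hadj, by
          rw [hc'p _ hi2, hc'p _ hi]; push_cast; rfl⟩
      · have hl : i + 1 = p.length := by omega
        have hv : p.getVert (i + 1) = p.getVert 0 := by rw [hl]; simp
        refine ⟨_, Or.inr ⟨0, by omega, hv.symm⟩, hadj, ?_⟩
        rw [hv, hc'p _ hi, hc'p 0 (by omega)]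
        have := (ZMod.natCast_eq_zero_iff p.length m).mpr hd
        rw [← hl] at this
        push_cast at this
        rw [this]; simp
  exact hu (hS.le_of_ge hP Set.subset_union_left (Or.inr ⟨0, by omega, by simp⟩))

/-- For `m ≥ 3` and a finite simple graph `B`, there is a coloring
`c : V → ZMod m` such that every vertex `x` has a neighbor `y` with
`c y = c x + 1` iff every connected component of `B` contains a cycle whose
length is divisible by `m`. -/
theorem stmt_0 (m : ℕ) (hm : 3 ≤ m) {V : Type*} [Fintype V] (B : SimpleGraph V) :
    (∃ c : V → ZMod m, ∀ x : V, ∃ y : V, B.Adj x y ∧ c y = c x + 1) ↔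
    (∀ v : V, ∃ u : V, B.Reachable v u ∧
      ∃ p : B.Walk u u, p.IsCycle ∧ m ∣ p.length) := by
  constructor
  · rintro ⟨c, h⟩ v
    choose f hf using h
    exact aux_forward m hm B c f (fun x => (hf x).1) (fun x => (hf x).2) v
  · exact aux_backward m B
end

section
/- Let G be a finite simple graph on a vertex type V and let G′ be its 2-subdivision: the simple graph on V ⊕ G.edgeSet in which Sum.inl v is adjacent to Sum.inr e exactly when v is an endpoint of the edge e, and there are no other adjacencies. Then G contains a cycle of even length if, and only if, G′ contains a cycle whose length is divisible by 4. -/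
/-- The 2-subdivision of a simple graph `G`: every edge of `G` is replaced by a
path of length 2 through a new vertex (one new vertex per edge). `Sum.inl v` is
adjacent to `Sum.inr e` exactly when `v` is an endpoint of the edge `e`; there
are no other adjacencies. -/
def twoSubdivision {V : Type*} (G : SimpleGraph V) : SimpleGraph (V ⊕ G.edgeSet) :=
  SimpleGraph.fromRel (fun a b =>
    match a, b with
    | Sum.inl v, Sum.inr e => v ∈ (e : Sym2 V)
    | _, _ => False)

theorem ts_adj_lr {V : Type*} {G : SimpleGraph V} {v : V} {e : G.edgeSet} :
    (twoSubdivision G).Adj (Sum.inl v) (Sum.inr e) ↔ v ∈ (e : Sym2 V) := by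
  simp [twoSubdivision]

theorem ts_adj_ll {V : Type*} {G : SimpleGraph V} {v w : V} :
    ¬ (twoSubdivision G).Adj (Sum.inl v) (Sum.inl w) := by
  simp [twoSubdivision]

theorem ts_adj_rr {V : Type*} {G : SimpleGraph V} {e f : G.edgeSet} :
    ¬ (twoSubdivision G).Adj (Sum.inr e) (Sum.inr f) := by
  simp [twoSubdivision]

theorem ts_adj_rl {V : Type*} {G : SimpleGraph V} {v : V} {e : G.edgeSet} :
    (twoSubdivision G).Adj (Sum.inr e) (Sum.inl v) ↔ v ∈ (e : Sym2 V) := by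
  rw [SimpleGraph.adj_comm, ts_adj_lr]

def subWalk {V : Type*} {G : SimpleGraph V} : {u v : V} → G.Walk u v →
    (twoSubdivision G).Walk (Sum.inl u) (Sum.inl v)
  | _, _, .nil => .nil
  | u, _, .cons (v := w) h p =>
    .cons (v := Sum.inr ⟨s(u, w), h⟩) (ts_adj_lr.2 (Sym2.mem_mk_left _ _))
      (.cons (ts_adj_rl.2 (Sym2.mem_mk_right _ _)) (subWalk p))

theorem subWalk_length {V : Type*} {G : SimpleGraph V} {u v : V} (p : G.Walk u v) :
    (subWalk p).length = 2 * p.length := by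
  induction p with
  | nil => rfl
  | cons h p ih => simp [subWalk, ih]; ring

theorem mem_subWalk_inl {V : Type*} {G : SimpleGraph V} {u v : V} (p : G.Walk u v) (x : V) :
    Sum.inl x ∈ (subWalk p).support ↔ x ∈ p.support := by
  induction p with
  | nil => simp [subWalk]
  | cons h p ih => simp [subWalk, ih]

theorem mem_subWalk_inr {V : Type*} {G : SimpleGraph V} {u v : V} (p : G.Walk u v)
    (e : G.edgeSet) :
    Sum.inr e ∈ (subWalk p).support ↔ (e : Sym2 V) ∈ p.edges := by
  induction p with
  | nil => simp [subWalk]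
  | cons h p ih => simp [subWalk, ih, Subtype.ext_iff]

theorem subWalk_isPath {V : Type*} {G : SimpleGraph V} {u v : V} (p : G.Walk u v) :
    (subWalk p).IsPath ↔ p.IsPath := by
  induction p with
  | nil => simp [subWalk]
  | cons h p ih =>
    simp only [subWalk, SimpleGraph.Walk.cons_isPath_iff, ih, mem_subWalk_inr,
      SimpleGraph.Walk.support_cons, List.mem_cons, mem_subWalk_inl, reduceCtorEq, false_or]
    constructor
    · rintro ⟨⟨a, b⟩, c⟩
      exact ⟨a, c⟩
    · rintro ⟨a, c⟩
      exact ⟨⟨a, fun hh => c (p.fst_mem_support_of_mem_edges hh)⟩, c⟩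

theorem subWalk_isCycle {V : Type*} {G : SimpleGraph V} {u : V} (p : G.Walk u u) :
    (subWalk p).IsCycle ↔ p.IsCycle := by
  cases p with
  | nil => simp [subWalk]
  | cons h p =>
    rw [SimpleGraph.Walk.cons_isCycle_iff, SimpleGraph.Walk.isCycle_iff_isPath_tail_and_le_length,
      subWalk_length]
    rw [SimpleGraph.Walk.isPath_def, SimpleGraph.Walk.support_tail_of_not_nil _ (by simp [subWalk])]
    simp only [subWalk, SimpleGraph.Walk.support_cons, List.tail_cons, List.nodup_cons,
      mem_subWalk_inr, ← SimpleGraph.Walk.isPath_def, subWalk_isPath]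
    rw [and_comm (a := p.IsPath)]
    constructor
    · rintro ⟨a, -⟩
      exact a
    · intro a
      refine ⟨a, ?_⟩
      cases p with
      | nil => exact (h.ne rfl).elim
      | cons h' p => simp; omega

theorem exists_subWalk {V : Type*} {G : SimpleGraph V} (n : ℕ) : ∀ {u v : V}
    (q : (twoSubdivision G).Walk (Sum.inl u) (Sum.inl v)), q.length ≤ n → q.IsTrail →
    ∃ p : G.Walk u v, subWalk p = q := by
  induction n using Nat.strong_induction_on with
  | _ n ih =>
  intro u v q hn hq
  match q, hn, hq with
  | .nil, _, _ => exact ⟨.nil, rfl⟩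
  | .cons (v := Sum.inl x) h _, _, _ => exact (ts_adj_ll h).elim
  | .cons (v := Sum.inr e) h (.cons (v := Sum.inr f) h' _), _, _ => exact (ts_adj_rr h').elim
  | .cons (v := Sum.inr ⟨e, he⟩) h (.cons (v := Sum.inl w) h' r), hn, hq =>
    simp only [SimpleGraph.Walk.length_cons] at hn
    have hr := hq.of_cons.of_cons
    obtain ⟨p, rfl⟩ := ih (n - 2) (by omega) r (by omega) hr
    have hne : u ≠ w := by
      rintro rfl
      rw [SimpleGraph.Walk.isTrail_cons] at hq
      simp [Sym2.eq_swap] at hq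
    have h1 := ts_adj_lr.1 h
    have h2 := ts_adj_rl.1 h'
    obtain rfl : e = s(u, w) := ((Sym2.mem_and_mem_iff hne).1 ⟨h1, h2⟩)
    exact ⟨.cons he p, rfl⟩

/-- `G` contains a cycle of even length iff its 2-subdivision
contains a cycle whose length is divisible by 4. -/
theorem stmt_2 {V : Type*} [Fintype V] (G : SimpleGraph V) :
    (∃ (u : V) (p : G.Walk u u), p.IsCycle ∧ Even p.length) ↔
    (∃ (u' : V ⊕ G.edgeSet) (p' : (twoSubdivision G).Walk u' u'),
      p'.IsCycle ∧ 4 ∣ p'.length) := by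
  classical
  constructor
  · rintro ⟨u, p, hp, k, hk⟩
    exact ⟨_, subWalk p, (subWalk_isCycle p).2 hp, by rw [subWalk_length]; omega⟩
  · rintro ⟨u', q, hq, hd⟩
    have key : ∀ (u : V) (q : (twoSubdivision G).Walk (Sum.inl u) (Sum.inl u)), q.IsCycle →
        4 ∣ q.length → ∃ (u : V) (p : G.Walk u u), p.IsCycle ∧ Even p.length := by
      intro u q hq hd
      obtain ⟨p, rfl⟩ := exists_subWalk _ q le_rfl hq.isTrail
      rw [subWalk_length] at hd
      exact ⟨u, p, (subWalk_isCycle p).1 hq, by rw [Nat.even_iff]; omega⟩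
    have hl : ∃ x : V, Sum.inl x ∈ q.support := by
      match u', q, hq with
      | Sum.inl x, q, _ => exact ⟨x, q.start_mem_support⟩
      | Sum.inr e, .nil, hq => simp at hq
      | Sum.inr e, .cons (v := Sum.inr f) h _, _ => exact (ts_adj_rr h).elim
      | Sum.inr e, .cons (v := Sum.inl x) h r, _ => exact ⟨x, by simp⟩
    obtain ⟨x, hx⟩ := hl
    exact key x (q.rotate _ hx) (hq.rotate hx) (by simpa using hd)
end

section
/- Let V be a finite type, E : V → V → Prop a directed edge relation on V, and s, t ∈ V. Let B be the simple graph on V × Fin 4 whose edges are exactly (writing v₀ = (v,0), v₁ = (v,1), v₂ = (v,2), v₃ = (v,3)): the pairs {v₀,v₁}, {v₂,v₃}, {v₀,v₂}, {v₁,v₃} for every v ∈ V; the pairs {u₀,v₂} for every u,v with E u v; and the two pairs {s₁,s₂} and {t₀,t₃}. Let S = V × {2,3}. Then there exists a set M ⊆ V × Fin 4 such that for all x, y with B.Adj x y: (if x ∈ S and y ∈ S then (x ∈ M ↔ y ∉ M)), (if x ∉ S and y ∉ S then (x ∈ M ↔ y ∉ M)), and (if x ∉ S and y ∈ S then (x ∈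 M → y ∈ M)) — if, and only if, t is NOT reachable from s in the directed graph, i.e., ¬ Relation.ReflTransGen E s t. -/
/-- The gadget graph of the reduction from directed non-reachability: on the
vertex set `V × Fin 4` (with `v₀ = (v,0)`, `v₁ = (v,1)`, `v₂ = (v,2)`,
`v₃ = (v,3)`), its edges are exactly the pairs `{v₀,v₁}`, `{v₂,v₃}`, `{v₀,v₂}`,
`{v₁,v₃}` for every `v`, the pairs `{u₀,v₂}` for every `u,v` with `E u v`, and
the two pairs `{s₁,s₂}` and `{t₀,t₃}`. -/
def gadgetGraph {V : Type*} (E : V → V → Prop) (s t : V) : SimpleGraph (V × Fin 4) :=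
  SimpleGraph.fromRel (fun a b =>
    (∃ v : V, a = (v, 0) ∧ b = (v, 1)) ∨
    (∃ v : V, a = (v, 2) ∧ b = (v, 3)) ∨
    (∃ v : V, a = (v, 0) ∧ b = (v, 2)) ∨
    (∃ v : V, a = (v, 1) ∧ b = (v, 3)) ∨
    (∃ u v : V, E u v ∧ a = (u, 0) ∧ b = (v, 2)) ∨
    (a = (s, 1) ∧ b = (s, 2)) ∨
    (a = (t, 0) ∧ b = (t, 3)))

/-- The set of shadow vertices: the copies with index 2 or 3. -/
def shadowSet (V : Type*) : Set (V × Fin 4) := {p | p.2 = 2 ∨ p.2 = 3}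

/-- there is a set `M` of vertices of the gadget graph satisfying
the three constraints on all edges iff `t` is not reachable from `s` in the
directed graph `E`. -/
theorem stmt_3 {V : Type*} [Fintype V] (E : V → V → Prop) (s t : V) :
    (∃ M : Set (V × Fin 4), ∀ x y : V × Fin 4, (gadgetGraph E s t).Adj x y →
      (x ∈ shadowSet V → y ∈ shadowSet V → (x ∈ M ↔ y ∉ M)) ∧
      (x ∉ shadowSet V → y ∉ shadowSet V → (x ∈ M ↔ y ∉ M)) ∧
      (x ∉ shadowSet V → y ∈ shadowSet V → (x ∈ M → y ∈ M))) ↔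
    ¬ Relation.ReflTransGen E s t := by
  constructor
  · rintro ⟨M, hM⟩ hst
    have h01 : ∀ v : V, ((v, 0) : V × Fin 4) ∈ M ↔ ((v, 1) : V × Fin 4) ∉ M := fun v =>
      (hM (v, 0) (v, 1) (by simp [gadgetGraph])).2.1
        (by simp [shadowSet]) (by simp [shadowSet])
    have h23 : ∀ v : V, ((v, 2) : V × Fin 4) ∈ M ↔ ((v, 3) : V × Fin 4) ∉ M := fun v =>
      (hM (v, 2) (v, 3) (by simp [gadgetGraph])).1
        (by simp [shadowSet]) (by simp [shadowSet])
    have h02 : ∀ v : V, ((v, 0) : V × Fin 4) ∈ M → ((v, 2) : V × Fin 4) ∈ M := fun v =>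
      (hM (v, 0) (v, 2) (by simp [gadgetGraph])).2.2
        (by simp [shadowSet]) (by simp [shadowSet])
    have h13 : ∀ v : V, ((v, 1) : V × Fin 4) ∈ M → ((v, 3) : V × Fin 4) ∈ M := fun v =>
      (hM (v, 1) (v, 3) (by simp [gadgetGraph])).2.2
        (by simp [shadowSet]) (by simp [shadowSet])
    have hE : ∀ u v : V, E u v → ((u, 0) : V × Fin 4) ∈ M → ((v, 2) : V × Fin 4) ∈ M :=
      fun u v huv =>
      (hM (u, 0) (v, 2) (by simp [gadgetGraph, huv])).2.2
        (by simp [shadowSet]) (by simp [shadowSet])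
    have hs : ((s, 1) : V × Fin 4) ∈ M → ((s, 2) : V × Fin 4) ∈ M :=
      (hM (s, 1) (s, 2) (by simp [gadgetGraph])).2.2
        (by simp [shadowSet]) (by simp [shadowSet])
    have ht : ((t, 0) : V × Fin 4) ∈ M → ((t, 3) : V × Fin 4) ∈ M :=
      (hM (t, 0) (t, 3) (by simp [gadgetGraph])).2.2
        (by simp [shadowSet]) (by simp [shadowSet])
    have key : ∀ v, Relation.ReflTransGen E s v → ((v, 0) : V × Fin 4) ∈ M := by
      intro v hv
      induction hv with
      | refl => have := h01 s; have := h23 s; have := h13 s; tauto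
      | @tail b c _ hbc ih =>
        have := h01 c; have := h23 c; have := h13 c; have := hE b c hbc; tauto
    have := key t hst
    have := h23 t; have := h02 t; tauto
  · intro hst
    refine ⟨{p | (p.2 = 0 ∨ p.2 = 2) ↔ Relation.ReflTransGen E s p.1}, ?_⟩
    rintro x y ⟨-, h⟩
    have hss : Relation.ReflTransGen E s s := Relation.ReflTransGen.refl
    rcases h with h | h <;>
    rcases h with ⟨v, rfl, rfl⟩ | ⟨v, rfl, rfl⟩ | ⟨v, rfl, rfl⟩ | ⟨v, rfl, rfl⟩ |
      ⟨u, v, huv, rfl, rfl⟩ | ⟨rfl, rfl⟩ | ⟨rfl, rfl⟩ <;>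
    simp [shadowSet, hst, hss]
    all_goals exact fun hu => hu.tail huv
end

section
/- Let G be a finite simple graph on a vertex type V that has at least one pair of distinct non-adjacent vertices. There exists a set X ⊆ V such that (i) for every pair of adjacent vertices x, y, neither x nor y lies in X, and (ii) for every pair of distinct non-adjacent vertices x, y, exactly one of x, y lies in X — if, and only if, there is a vertex v such that v has no neighbors in G and any two distinct vertices different from v are adjacent in G (i.e., the complement of G is a star centered at v). -/
/-- let `G` be a finite simple graph with at least one pair of
distinct non-adjacent vertices. `G` admits a set `X` such that no endpoint of
any edge lies in `X` and every distinct non-adjacent pair has exactly one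
element in `X` iff the complement of `G` is a star: there is a vertex `v` with
no neighbors such that any two distinct vertices different from `v` are
adjacent. -/
theorem stmt_6 {V : Type*} [Fintype V] (G : SimpleGraph V)
    (h : ∃ x y : V, x ≠ y ∧ ¬ G.Adj x y) :
    (∃ X : Set V,
      (∀ x y : V, G.Adj x y → x ∉ X ∧ y ∉ X) ∧
      (∀ x y : V, x ≠ y → ¬ G.Adj x y → (x ∈ X ↔ y ∉ X))) ↔
    (∃ v : V, (∀ u : V, ¬ G.Adj v u) ∧
      ∀ x y : V, x ≠ v → y ≠ v → x ≠ y → G.Adj x y) := by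
  constructor
  · rintro ⟨X, h1, h2⟩
    have hv : ∃ v, v ∈ X := by
      obtain ⟨x, y, hne, hxy⟩ := h
      by_cases hx : x ∈ X
      · exact ⟨x, hx⟩
      · exact ⟨y, by_contra fun hy => hx ((h2 x y hne hxy).2 hy)⟩
    obtain ⟨v, hv⟩ := hv
    have hn : ∀ u, ¬ G.Adj v u := fun u hu => (h1 v u hu).1 hv
    have ho : ∀ u, u ≠ v → u ∉ X := fun u hu => (h2 v u hu.symm (hn u)).1 hv
    refine ⟨v, hn, fun x y hx hy hxy => ?_⟩
    by_contra hadj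
    exact ho x hx ((h2 x y hxy hadj).2 (ho y hy))
  · rintro ⟨v, hn, hc⟩
    refine ⟨{v}, fun x y hxy => ⟨?_, ?_⟩, fun x y hne hxy => ⟨?_, ?_⟩⟩
    · rintro rfl
      exact hn y hxy
    · rintro rfl
      exact hn x hxy.symm
    · rintro rfl hy
      exact hne hy.symm
    · intro hy
      by_contra hx
      exact hxy (hc x y hx hy hne)
end

section
/- Let G be a finite simple graph on a vertex type V that has at least one edge. There exists a set X ⊆ V such that (i) for every pair of adjacent vertices x, y, exactly one of x, y lies in X, and (ii) for every pair of distinct non-adjacent vertices x, y, not both of x, y lie in X — if, and only if, there is a vertex v that is incident to every edge of G. -/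
/-- let `G` be a finite simple graph with at least one edge. `G`
admits a set `X` such that every edge has exactly one endpoint in `X` and
every distinct non-adjacent pair has at most one element in `X` iff there is a
vertex `v` incident to every edge of `G`. -/
theorem stmt_7 {V : Type*} [Fintype V] (G : SimpleGraph V)
    (h : ∃ x y : V, G.Adj x y) :
    (∃ X : Set V,
      (∀ x y : V, G.Adj x y → (x ∈ X ↔ y ∉ X)) ∧
      (∀ x y : V, x ≠ y → ¬ G.Adj x y → ¬ (x ∈ X ∧ y ∈ X))) ↔
    (∃ v : V, ∀ x y : V, G.Adj x y → x = v ∨ y = v) := by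
  constructor
  · rintro ⟨X, h1, h2⟩
    have huniq : ∀ a b : V, a ∈ X → b ∈ X → a = b := by
      intro a b ha hb
      by_contra hne
      by_cases hadj : G.Adj a b
      · exact (h1 a b hadj).1 ha hb
      · exact h2 a b hne hadj ⟨ha, hb⟩
    have hcover : ∀ x y : V, G.Adj x y → x ∈ X ∨ y ∈ X := by
      intro x y hxy
      by_cases hy : y ∈ X
      · exact Or.inr hy
      · exact Or.inl ((h1 x y hxy).2 hy)
    obtain ⟨v, hv⟩ : ∃ v, v ∈ X := by
      obtain ⟨x, y, hxy⟩ := h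
      rcases hcover x y hxy with hx | hy
      · exact ⟨x, hx⟩
      · exact ⟨y, hy⟩
    exact ⟨v, fun x y hxy => (hcover x y hxy).imp
      (fun hx => huniq x v hx hv) (fun hy => huniq y v hy hv)⟩
  · rintro ⟨v, hv⟩
    refine ⟨{v}, fun x y hxy => ?_, fun x y hne _ hxy => ?_⟩
    · simp only [Set.mem_singleton_iff]
      constructor
      · intro hx hy
        exact hxy.ne (hx.trans hy.symm)
      · intro hy
        exact (hv x y hxy).resolve_right hy
    · exact hne (hxy.1.trans hxy.2.symm)
end

section
/- Let G be a finite simple graph on a vertex type V. If there exists a set X ⊆ V such that (i) for every pair of adjacent vertices x, y, neither x nor y lies in X, and (ii) for every pair of distinct non-adjacent vertices x, y, at least one of x, y lies in X — then the set X₀ = { v : V | v has no neighbors in G } also satisfies conditions (i) and (ii). -/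
/-- if a finite simple graph `G` admits a set `X` such that no
endpoint of any edge lies in `X` and every distinct non-adjacent pair has at
least one element in `X`, then the set of isolated vertices of `G` satisfies
the same two conditions. -/
theorem stmt_8 {V : Type*} [Fintype V] (G : SimpleGraph V)
    (h : ∃ X : Set V,
      (∀ x y : V, G.Adj x y → x ∉ X ∧ y ∉ X) ∧
      (∀ x y : V, x ≠ y → ¬ G.Adj x y → x ∈ X ∨ y ∈ X)) :
    (∀ x y : V, G.Adj x y →
        x ∉ {v : V | ∀ u : V, ¬ G.Adj v u} ∧ y ∉ {v : V | ∀ u : V, ¬ G.Adj v u}) ∧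
    (∀ x y : V, x ≠ y → ¬ G.Adj x y →
        x ∈ {v : V | ∀ u : V, ¬ G.Adj v u} ∨ y ∈ {v : V | ∀ u : V, ¬ G.Adj v u}) := by
  obtain ⟨X, h1, h2⟩ := h
  refine ⟨fun x y hxy => ⟨fun hx => hx y hxy, fun hy => hy x hxy.symm⟩, fun x y hne hn => ?_⟩
  rcases h2 x y hne hn with hx | hy
  · exact Or.inl fun u hu => (h1 x u hu).1 hx
  · exact Or.inr fun u hu => (h1 y u hu).1 hy
end

section
/- Let A⊕, A⊖ : Bool → Bool → Prop be arc relations such that each of A⊕ and A⊖ contains a directed cycle, i.e., there exist a, b with A⊕ a b and A⊕ b a, and there exist a′, b′ with A⊖ a′ b′ and A⊖ b′ a′. Then every finite simple graph B on a vertex type V with at least two vertices can be saturated with respect to the pattern (Bool, A⊕, A⊖): there exist c : V → Bool and w : V → V such that for every vertex x: w x ≠ x, A⊕ (c x) (c (w x)) holds whenever x is adjacent to w x, and A⊖ (c x) (c (w x)) holds whenever x is not adjacent to w x. -/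
theorem cyc_aux (A : Bool → Bool → Prop) (h : ∃ a b : Bool, A a b ∧ A b a) :
    (∃ a, A a a) ∨ (∀ a b, a ≠ b → A a b) := by
  obtain ⟨a, b, h1, h2⟩ := h
  by_cases hab : a = b
  · subst hab; exact Or.inl ⟨a, h1⟩
  · right
    intro x y hxy
    cases a <;> cases b <;> cases x <;> cases y <;> first | exact h1 | exact h2 | exact absurd rfl hab | exact absurd rfl hxy

/-- One relation has a loop, the other a two-cycle. -/
theorem mixed_aux (P Q : Bool → Bool → Prop) {V : Type*} (R : V → V → Prop)
    (hR : ∀ x y, R x y → R y x) (hne : ∀ x : V, ∃ y, y ≠ x)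
    (a : Bool) (hP : P a a) (hQ : ∀ a b, a ≠ b → Q a b) :
    ∃ c : V → Bool, ∀ x : V, ∃ y, y ≠ x ∧ (R x y → P (c x) (c y)) ∧
      (¬ R x y → Q (c x) (c y)) := by
  classical
  by_cases hI : ∃ z, ∀ y, y ≠ z → ¬ R z y
  · obtain ⟨z, hz⟩ := hI
    refine ⟨fun x => if x = z then !a else a, fun x => ?_⟩
    by_cases hx : x = z
    · subst hx
      obtain ⟨y, hy⟩ := hne x
      exact ⟨y, hy, fun h => absurd h (hz y hy), fun _ => hQ _ _ (by simp [hy])⟩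
    · exact ⟨z, Ne.symm hx, fun h => absurd (hR _ _ h) (hz x hx),
        fun _ => hQ _ _ (by simp [hx])⟩
  · push Not at hI
    refine ⟨fun _ => a, fun x => ?_⟩
    obtain ⟨y, hy, h⟩ := hI x
    exact ⟨y, hy, fun _ => hP, fun hn => absurd h hn⟩

/-- if both arc relations `A⊕` and `A⊖` on the two-element color
set `Bool` contain a directed cycle, then every finite simple graph with at
least two vertices can be saturated with respect to the pattern
`(Bool, A⊕, A⊖)`. -/
theorem stmt_10 (Aplus Aminus : Bool → Bool → Prop)
    (hplus : ∃ a b : Bool, Aplus a b ∧ Aplus b a)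
    (hminus : ∃ a b : Bool, Aminus a b ∧ Aminus b a)
    {V : Type*} [Fintype V] (B : SimpleGraph V)
    (hV : 2 ≤ Fintype.card V) :
    ∃ (c : V → Bool) (w : V → V), ∀ x : V, w x ≠ x ∧
      (B.Adj x (w x) → Aplus (c x) (c (w x))) ∧
      (¬ B.Adj x (w x) → Aminus (c x) (c (w x))) := by
  classical
  have : Nontrivial V := Fintype.one_lt_card_iff_nontrivial.mp hV
  have hne : ∀ x : V, ∃ y, y ≠ x := fun x => exists_ne x
  suffices h : ∃ c : V → Bool, ∀ x : V, ∃ y, y ≠ x ∧ (B.Adj x y → Aplus (c x) (c y)) ∧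
      (¬ B.Adj x y → Aminus (c x) (c y)) by
    obtain ⟨c, hc⟩ := h
    choose w hw using hc
    exact ⟨c, w, hw⟩
  rcases cyc_aux _ hplus with ⟨a, ha⟩ | hp <;> rcases cyc_aux _ hminus with ⟨b, hb⟩ | hm
  · by_cases hab : a = b
    · subst hab
      refine ⟨fun _ => a, fun x => ?_⟩
      obtain ⟨y, hy⟩ := hne x
      exact ⟨y, hy, fun _ => ha, fun _ => hb⟩
    · by_cases hI : ∃ z, (∀ y, ¬ B.Adj z y) ∧ ∀ z', (∀ y, ¬ B.Adj z' y) → z' = z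
      · obtain ⟨z, hz, -⟩ := hI
        refine ⟨fun _ => b, fun x => ?_⟩
        by_cases hx : x = z
        · subst hx
          obtain ⟨y, hy⟩ := hne x
          exact ⟨y, hy, fun h => absurd h (hz y), fun _ => hb⟩
        · exact ⟨z, Ne.symm hx, fun h => absurd h.symm (hz x), fun _ => hb⟩
      · push Not at hI
        refine ⟨fun x => if ∀ y, ¬ B.Adj x y then b else a, fun x => ?_⟩
        by_cases hx : ∀ y, ¬ B.Adj x y
        · obtain ⟨y, hy, hyx⟩ := hI x hx
          refine ⟨y, hyx, fun h => absurd h (hx y), fun _ => ?_⟩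
          simp only [if_pos hx, if_pos hy]; exact hb
        · have hx' := hx
          push Not at hx'
          obtain ⟨y, hy⟩ := hx'
          have hy' : ¬ ∀ u, ¬ B.Adj y u := fun h => h x hy.symm
          refine ⟨y, hy.ne', fun _ => ?_, fun h => absurd hy h⟩
          simp only [if_neg hx, if_neg hy']; exact ha
  · exact mixed_aux Aplus Aminus B.Adj (fun _ _ h => h.symm) hne a ha hm
  · obtain ⟨c, hc⟩ := mixed_aux Aminus Aplus (fun x y => ¬ B.Adj x y)
      (fun _ _ h h' => h h'.symm) hne b hb hp
    refine ⟨c, fun x => ?_⟩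
    obtain ⟨y, h1, h2, h3⟩ := hc x
    exact ⟨y, h1, fun h => h3 (not_not.mpr h), h2⟩
  · obtain ⟨z⟩ := (inferInstance : Nonempty V)
    refine ⟨fun x => decide (x = z), fun x => ?_⟩
    by_cases hx : x = z
    · subst hx
      obtain ⟨y, hy⟩ := hne x
      exact ⟨y, hy, fun _ => hp _ _ (by simp [hy]), fun _ => hm _ _ (by simp [hy])⟩
    · exact ⟨z, Ne.symm hx, fun _ => hp _ _ (by simp [hx]), fun _ => hm _ _ (by simp [hx])⟩
end

section
/- Let G be a finite simple graph on a vertex type V in which every vertex has at least one neighbor. Then there exist a coloring c : V → Bool and a function w : V → V such that for every vertex x: x is adjacent to w x and c (w x) = ¬ c x. -/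
/-- in a finite simple graph in which every vertex has at least
one neighbor, there are a 2-coloring `c : V → Bool` and a function `w : V → V`
such that every vertex `x` is adjacent to `w x` and `w x` has the opposite
color of `x`. -/
theorem stmt_11 {V : Type*} [Fintype V] (G : SimpleGraph V)
    (h : ∀ v : V, ∃ u : V, G.Adj v u) :
    ∃ (c : V → Bool) (w : V → V), ∀ x : V,
      G.Adj x (w x) ∧ c (w x) = ! c x := by
  let r : V → V := fun x => (G.connectedComponentMk x).out
  have hr : ∀ x, G.Reachable x (r x) := fun x =>
    (SimpleGraph.ConnectedComponent.exact (Quot.out_eq (G.connectedComponentMk x))).symm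
  have hadj : ∀ x u, G.Adj x u → r u = r x := fun x u hxu => by
    have : G.connectedComponentMk u = G.connectedComponentMk x :=
      SimpleGraph.ConnectedComponent.sound hxu.symm.reachable
    simp only [r, this]
  have key : ∀ x, ∃ u, G.Adj x u ∧
      decide (G.dist u (r u) % 2 = 0) = ! decide (G.dist x (r x) % 2 = 0) := by
    intro x
    obtain ⟨p, hp⟩ := (hr x).exists_walk_length_eq_dist
    generalize hy : r x = y at p hp
    cases p with
    | nil =>
      obtain ⟨u, hu⟩ := h x
      refine ⟨u, hu, ?_⟩
      have h1 : G.dist u x = 1 := SimpleGraph.dist_eq_one_iff_adj.2 hu.symm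
      rw [hadj x u hu, hy, h1]
      simp
    | @cons _ u _ hu q =>
      refine ⟨u, hu, ?_⟩
      have h1 : G.dist u y ≤ q.length := SimpleGraph.dist_le q
      obtain ⟨q', hq'⟩ := q.reachable.exists_walk_length_eq_dist
      have h2 := SimpleGraph.dist_le (SimpleGraph.Walk.cons hu q')
      simp only [SimpleGraph.Walk.length_cons] at hp h2
      have h3 : G.dist x y = G.dist u y + 1 := by omega
      rw [hadj x u hu, hy, h3, ← decide_not]
      congr 1
      apply propext
      omega
  choose w hw using key
  exact ⟨fun x => decide (G.dist x (r x) % 2 = 0), w, hw⟩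
end

section
/- Consider the pattern graph on colors Bool with black = true and white = false, A⊕ = {(true,true), (false,true)} and A⊖ = {(true,false)}. Let B be a finite simple graph on a nonempty finite vertex type V. Then B can be saturated with respect to this pattern — i.e., there exist c : V → Bool and w : V → V such that for every x: w x ≠ x, (c x, c (w x)) ∈ A⊕ whenever x is adjacent to w x, and (c x, c (w x)) ∈ A⊖ whenever x is not adjacent to w x — if, and only if, either every vertex of B has at least one neighbor, or B has at least two edges. -/
open Classical in
theorem sat_of_white {V : Type*} (B : SimpleGraph V) (S : V → Prop)
    (h : ∀ x, (B.Adj x x → False) → (S x → ∃ y, B.Adj x y ∧ ¬ S y) ∧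
      (¬ S x → (∃ y, B.Adj x y ∧ ¬ S y) ∨ ∃ y, ¬ B.Adj x y ∧ S y)) :
    ∃ (c : V → Bool) (w : V → V), ∀ x : V, w x ≠ x ∧
      (B.Adj x (w x) →
        ((c x, c (w x)) = (true, true) ∨ (c x, c (w x)) = (false, true))) ∧
      (¬ B.Adj x (w x) → (c x, c (w x)) = (true, false)) := by
  have key : ∀ x, ∃ y, (B.Adj x y ∧ ¬ S y) ∨ (¬ S x ∧ ¬ B.Adj x y ∧ S y) := by
    intro x
    obtain ⟨h1, h2⟩ := h x (B.irrefl)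
    by_cases hx : S x
    · obtain ⟨y, hy⟩ := h1 hx
      exact ⟨y, Or.inl hy⟩
    · rcases h2 hx with ⟨y, hy⟩ | ⟨y, hy⟩
      · exact ⟨y, Or.inl hy⟩
      · exact ⟨y, Or.inr ⟨hx, hy⟩⟩
  choose w hw using key
  refine ⟨fun x => decide (¬ S x), w, fun x => ?_⟩
  rcases hw x with ⟨h1, h2⟩ | ⟨h1, h2, h3⟩
  · refine ⟨h1.ne', fun _ => ?_, fun h => absurd h1 h⟩
    by_cases hx : S x <;> simp [hx, h2]
  · refine ⟨fun e => h1 (e ▸ h3), fun h => absurd h h2, fun _ => ?_⟩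
    simp [h1, h3]



/-- for the pattern graph on `Bool` (black = `true`, white =
`false`) with `A⊕ = {(true,true), (false,true)}` and `A⊖ = {(true,false)}`, a
finite simple graph `B` on a nonempty vertex type can be saturated iff either
every vertex has at least one neighbor, or `B` has at least two edges. -/
theorem stmt_12 {V : Type*} [Fintype V] [Nonempty V] (B : SimpleGraph V) :
    (∃ (c : V → Bool) (w : V → V), ∀ x : V, w x ≠ x ∧
      (B.Adj x (w x) →
        ((c x, c (w x)) = (true, true) ∨ (c x, c (w x)) = (false, true))) ∧
      (¬ B.Adj x (w x) → (c x, c (w x)) = (true, false))) ↔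
    ((∀ v : V, ∃ u : V, B.Adj v u) ∨ 2 ≤ B.edgeSet.ncard) := by
  constructor
  · rintro ⟨c, w, h⟩
    by_contra! hcon
    obtain ⟨⟨v, hv⟩, hcard⟩ := hcon
    have black : ∀ x, c x = false → B.Adj x (w x) ∧ c (w x) = true := by
      intro x hx
      obtain ⟨-, h1, h2⟩ := h x
      by_cases ha : B.Adj x (w x)
      · have := h1 ha
        simp [hx] at this
        exact ⟨ha, this⟩
      · have := h2 ha
        simp [hx] at this
    have hu : c (w v) = false := by
      have := (h v).2.2 (hv _)
      simp at this
      exact this.2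
    obtain ⟨hub, hb⟩ := black _ hu
    set u := w v
    set b := w u
    have two : ∀ p q, B.Adj p q → s(p, q) = s(u, b) := by
      intro p q hpq
      by_contra hne
      have : 1 < B.edgeSet.ncard := by
        rw [Set.one_lt_ncard (Set.toFinite _)]
        exact ⟨s(p, q), hpq, s(u, b), hub, hne⟩
      omega
    obtain ⟨hbne, h1, h2⟩ := h b
    by_cases ha : B.Adj b (w b)
    · have e := two _ _ ha
      have := h1 ha
      simp at this e
      grind
    · have := h2 ha
      simp at this
      obtain ⟨hef, hf⟩ := black _ this.2
      have e := two _ _ hef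
      have hs := hub.symm
      simp at e
      grind
  · intro h
    by_cases hall : ∀ v : V, ∃ u : V, B.Adj v u
    · apply sat_of_white B (fun _ => False)
      intro x _
      simpa using hall x
    have hcard := h.resolve_left hall
    by_cases hdeg : ∃ b p q, B.Adj b p ∧ B.Adj b q ∧ p ≠ q
    · obtain ⟨b, p, q, hp, hq, hpq⟩ := hdeg
      have hexa : ∃ a, (∃ y, B.Adj a y) ∧ ∀ x, B.Adj x a → ∃ y, B.Adj x y ∧ y ≠ a := by
        by_cases hb : ∀ x, B.Adj x b → ∃ y, B.Adj x y ∧ y ≠ b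
        · exact ⟨b, ⟨p, hp⟩, hb⟩
        · push Not at hb
          obtain ⟨l, hl, hl'⟩ := hb
          refine ⟨l, ⟨b, hl⟩, fun x hx => ?_⟩
          obtain rfl := hl' x hx.symm
          by_cases e : p = l
          · exact ⟨q, hq, fun e' => hpq (e.trans e'.symm)⟩
          · exact ⟨p, hp, e⟩
      obtain ⟨a, ⟨y, hy⟩, ha⟩ := hexa
      apply sat_of_white B (fun x => x = a)
      intro x _
      refine ⟨?_, fun hx => ?_⟩
      · rintro rfl
        exact ⟨y, hy, hy.ne'⟩
      · by_cases hxa : B.Adj x a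
        · exact Or.inl (ha x hxa)
        · exact Or.inr ⟨a, hxa, rfl⟩
    · push Not at hdeg
      obtain ⟨e, he, f, hf, hne⟩ := (Set.one_lt_ncard (Set.toFinite _)).1 hcard
      induction e using Sym2.ind with | _ a b => ?_
      induction f using Sym2.ind with | _ p q => ?_
      rw [SimpleGraph.mem_edgeSet] at he hf
      have he' := he.symm
      have hf' := hf.symm
      simp at hne
      apply sat_of_white B (fun x => x = a ∨ x = p)
      intro x _
      have h1 := hdeg x a p
      have h2 := hdeg a b
      have h3 := hdeg p q
      have h4 := hdeg b a
      have h5 := hdeg q p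
      have hab := he.ne
      have hpq := hf.ne
      have hap : a ≠ p := by
        rintro rfl
        exact hne.1 rfl (h2 q he hf)
      have hbp : b ≠ p := by
        rintro rfl
        exact hne.2 (h3 a hf he').symm rfl
      have haq : a ≠ q := by
        rintro rfl
        exact hne.2 rfl (h2 p he hf')
      refine ⟨?_, fun hx => Or.inr ?_⟩
      · rintro (rfl | rfl)
        · exact ⟨b, he, by grind⟩
        · exact ⟨q, hf, by grind⟩
      · by_cases hxa : B.Adj x a
        · exact ⟨p, fun hxp => hap (h1 hxa hxp), Or.inr rfl⟩
        · exact ⟨a, hxa, Or.inl rfl⟩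
end

section
/- Consider a pattern graph on colors Bool with black = true and white = false, with A⊖ = {(true,false)} and an arc relation A⊕ on which white lies on a directed cycle, i.e., (false,false) ∈ A⊕, or both (false,true) ∈ A⊕ and (true,false) ∈ A⊕. Then every finite simple graph B on a vertex type V that has at least one edge can be saturated with respect to this pattern: there exist c : V → Bool and w : V → V such that for every x: w x ≠ x, (c x, c (w x)) ∈ A⊕ whenever x is adjacent to w x, and (c x, c (w x)) ∈ A⊖ whenever x is not adjacent to w x. -/
/-- consider a pattern graph on `Bool` (black = `true`, white =
`false`) with `A⊖ = {(true,false)}` and an arc relation `A⊕` on which white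
lies on a directed cycle, i.e., `(false,false) ∈ A⊕`, or both
`(false,true) ∈ A⊕` and `(true,false) ∈ A⊕`. Then every finite simple graph
with at least one edge can be saturated with respect to this pattern. -/
theorem stmt_14 (Aplus : Bool → Bool → Prop)
    (hwhite : Aplus false false ∨ (Aplus false true ∧ Aplus true false))
    {V : Type*} [Fintype V] (B : SimpleGraph V)
    (h : ∃ x y : V, B.Adj x y) :
    ∃ (c : V → Bool) (w : V → V), ∀ x : V, w x ≠ x ∧
      (B.Adj x (w x) → Aplus (c x) (c (w x))) ∧
      (¬ B.Adj x (w x) → (c x, c (w x)) = (true, false)) := by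
  classical
  rcases hwhite with hff | ⟨hft, htf⟩
  · obtain ⟨a, b, hab⟩ := h
    refine ⟨fun x => decide (¬ ∃ y, B.Adj x y),
      fun x => if hx : ∃ y, B.Adj x y then hx.choose else a, fun x => ?_⟩
    have ha : ∃ y, B.Adj a y := ⟨b, hab⟩
    by_cases hx : ∃ y, B.Adj x y
    · have h1 := hx.choose_spec
      have h2 : ∃ y, B.Adj hx.choose y := ⟨x, h1.symm⟩
      simp only [dif_pos hx]
      refine ⟨h1.ne', fun _ => ?_, fun hn => absurd h1 hn⟩
      rw [decide_eq_false (not_not.mpr hx), decide_eq_false (not_not.mpr h2)]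
      exact hff
    · simp only [dif_neg hx]
      refine ⟨fun e => hx (e ▸ ha), fun hn => absurd ⟨a, hn⟩ hx, fun _ => ?_⟩
      rw [decide_eq_true hx, decide_eq_false (not_not.mpr ha)]
  · obtain ⟨S, -, hS⟩ := Finite.exists_le_maximal
      (p := fun S : Set V => ∀ x ∈ S, ∀ y ∈ S, ¬ B.Adj x y) (a := ∅) (by simp)
    have hdom : ∀ x, x ∉ S → ∃ y ∈ S, B.Adj x y := by
      intro x hx
      by_contra! hno
      apply hx
      have hi : ∀ u ∈ insert x S, ∀ v ∈ insert x S, ¬ B.Adj u v := by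
        rintro u (rfl | hu) v (rfl | hv)
        · exact B.irrefl
        · exact hno v hv
        · exact fun e => hno u hu e.symm
        · exact hS.prop u hu v hv
      exact hS.le_of_ge hi (Set.subset_insert x S) (Set.mem_insert x S)
    obtain ⟨a, ha⟩ : ∃ a, a ∉ S := by
      obtain ⟨u, v, huv⟩ := h
      by_contra! hall
      exact hS.prop u (hall u) v (hall v) huv
    have key : ∀ x, ∃ y, y ≠ x ∧ (B.Adj x y → Aplus (decide (x ∈ S)) (decide (y ∈ S))) ∧
        (¬ B.Adj x y → (decide (x ∈ S), decide (y ∈ S)) = (true, false)) := by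
      intro x
      by_cases hx : x ∈ S
      · refine ⟨a, fun e => ha (e ▸ hx), fun _ => ?_, fun _ => ?_⟩
        · simpa [hx, ha] using htf
        · simp [hx, ha]
      · obtain ⟨y, hy, hxy⟩ := hdom x hx
        refine ⟨y, hxy.ne', fun _ => ?_, fun hn => absurd hxy hn⟩
        simpa [hx, hy] using hft
    choose w hw using key
    exact ⟨fun x => decide (x ∈ S), w, hw⟩
end
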